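/- Let f : ℂ → ℂ be strictly monotone with f(0) = 0, and let x : I → ℂ be differentiable on an interval I with x′(t) = f(x(t)) and x(t) ≠ 0 for all t ∈ I. Then the function t ↦ |x(t)| is differentiable on I with derivative ⟨f(x(t)), x(t)⟩/|x(t)| > 0; in particular, t ↦ |x(t)| is strictly increasing on I. -/

import Mathlib

/-- The norm of a differentiable curve is differentiable away from the origin. -/
theorem HasDerivAt.norm_of_ne_zero {x : ℝ → ℂ} {v : ℂ} {t : ℝ}
    (hx : HasDerivAt x v t) (h0 : x t ≠ 0) :
    HasDerivAt (fun s => ‖x s‖) ((v * (starRingEnd ℂ) (x t)).re / ‖x t‖) t := by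
  have h := hx.norm_sq.sqrt (by simpa using h0)
  simp only [Real.sqrt_sq (norm_nonneg _)] at h
  rw [mul_div_mul_left _ _ two_ne_zero] at h
  simpa [Complex.inner, mul_comm] using h

/-- Along a trajectory of a strictly monotone field `f` with `f(0) = 0` staying
away from the origin, the distance to the origin `t ↦ |x(t)|` is differentiable
with positive derivative `⟨f(x(t)), x(t)⟩/|x(t)|`; in particular it is strictly
increasing. -/
theorem stmt11 (f : ℂ → ℂ)
    (hsm : ∀ a b : ℂ, a ≠ b → 0 < ((f a - f b) * (starRingEnd ℂ) (a - b)).re)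
    (hf0 : f 0 = 0) (I : Set ℝ) (hI : I.OrdConnected) (x : ℝ → ℂ)
    (hx0 : ∀ t ∈ I, x t ≠ 0)
    (hx : ∀ t ∈ I, HasDerivAt x (f (x t)) t) :
    (∀ t ∈ I,
      HasDerivAt (fun s => ‖x s‖) ((f (x t) * (starRingEnd ℂ) (x t)).re / ‖x t‖) t ∧
        0 < (f (x t) * (starRingEnd ℂ) (x t)).re / ‖x t‖) ∧
      StrictMonoOn (fun t => ‖x t‖) I := by
  have key : ∀ t ∈ I,
      HasDerivAt (fun s => ‖x s‖) ((f (x t) * (starRingEnd ℂ) (x t)).re / ‖x t‖) t ∧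
        0 < (f (x t) * (starRingEnd ℂ) (x t)).re / ‖x t‖ := fun t ht =>
    ⟨(hx t ht).norm_of_ne_zero (hx0 t ht),
      div_pos (by simpa only [hf0, sub_zero] using hsm (x t) 0 (hx0 t ht))
        (norm_pos_iff.mpr (hx0 t ht))⟩
  refine ⟨key, strictMonoOn_of_deriv_pos hI.convex
    (fun t ht => (key t ht).1.continuousAt.continuousWithinAt) fun t ht => ?_⟩
  obtain ⟨hd, hpos⟩ := key t (interior_subset ht)
  rwa [hd.deriv]
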